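/- Let α, β, η, γ be real numbers with (α,β) ≠ (0,0) and (η,γ) ≠ (0,0), let ρ₁ > 0, ρ₂ > 0, let r* be the unique nonnegative solution of the CF fixed-point equation, and let R_cf = R_w(α,β,ρ₁(1−2^{−r*})). Then R_cf ≤ min{R_w(α,β,ρ₁), R_w^{wf}(η,γ,ρ₂)}; that is, the CF rate respects the cut-set-like upper bound R_ub = min{R_w(α,β,ρ₁), R_w^{wf}(η,γ,ρ₂)}. -/

import Mathlib

/-- The channel gain function `H_{a,b}(f) = b + 2a·cos(2πf)`. -/
noncomputable def Hf (a b f : ℝ) : ℝ := b + 2 * a * Real.cos (2 * Real.pi * f)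

/-- The Wyner per-cell sum-rate `R_w(a,b,ρ) = ∫₀¹ log₂(1 + ρ·H_{a,b}(f)²) df`. -/
noncomputable def Rw (a b ρ : ℝ) : ℝ :=
  ∫ f in (0:ℝ)..1, Real.logb 2 (1 + ρ * (Hf a b f) ^ 2)

theorem continuous_Hf (a b : ℝ) : Continuous (Hf a b) := by
  unfold Hf
  fun_prop

theorem intervalIntegrable_rate (a b ρ : ℝ) (hρ : 0 ≤ ρ) :
    IntervalIntegrable (fun f => Real.logb 2 (1 + ρ * (Hf a b f) ^ 2))
      MeasureTheory.volume 0 1 := by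
  apply Continuous.intervalIntegrable
  have := continuous_Hf a b
  refine Continuous.logb (by fun_prop) fun f => ?_
  positivity

/-- The Wyner sum-rate is monotone in the power. -/
theorem Rw_mono (a b : ℝ) {ρ ρ' : ℝ} (hρ : 0 ≤ ρ) (h : ρ ≤ ρ') : Rw a b ρ ≤ Rw a b ρ' := by
  refine intervalIntegral.integral_mono_on zero_le_one (intervalIntegrable_rate a b ρ hρ)
    (intervalIntegrable_rate a b ρ' (hρ.trans h)) fun f _ => ?_
  refine Real.logb_le_logb_of_le one_lt_two (by positivity) ?_
  gcongr

theorem waterfilling_mul_sq (ν x : ℝ) :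
    max (ν - (x ^ 2)⁻¹) 0 * x ^ 2 = max (ν * x ^ 2 - 1) 0 := by
  rcases eq_or_ne x 0 with rfl | hx
  · simp
  · rw [max_mul_of_nonneg _ _ (sq_nonneg x), sub_mul, inv_mul_cancel₀ (pow_ne_zero 2 hx), zero_mul]

/-- The waterfilling power maximizes the Lagrangian with multiplier `(ν * log 2)⁻¹` pointwise. -/
theorem logb_le_waterfilling_add {ν ρ : ℝ} (x : ℝ) (hν : 0 < ν) (hρ : 0 ≤ ρ) :
    Real.logb 2 (1 + ρ * x ^ 2) ≤ Real.logb 2 (1 + max (ν - (x ^ 2)⁻¹) 0 * x ^ 2) +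
      (ρ - if x = 0 then 0 else max (ν - (x ^ 2)⁻¹) 0) * (ν * Real.log 2)⁻¹ := by
  have hl : 0 < Real.log 2 := Real.log_pos one_lt_two
  rcases eq_or_ne x 0 with rfl | hx
  · simp only [ne_eq, OfNat.ofNat_ne_zero, not_false_eq_true, zero_pow, mul_zero, add_zero,
      Real.logb_one, if_true, sub_zero, zero_add]
    positivity
  have hx2 : 0 < x ^ 2 := by positivity
  rw [if_neg hx]
  set P := max (ν - (x ^ 2)⁻¹) 0 with hP
  have hP0 : 0 ≤ P := le_max_right _ _
  have hA : 0 < 1 + ρ * x ^ 2 := by positivity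
  have hB : 0 < 1 + P * x ^ 2 := by positivity
  have slope : (ρ - P) * x ^ 2 / (1 + P * x ^ 2) ≤ (ρ - P) / ν := by
    rw [div_le_div_iff₀ hB hν]
    rcases le_total (ν - (x ^ 2)⁻¹) 0 with h | h
    · rw [max_eq_right h] at hP
      have h1 : ν * x ^ 2 ≤ 1 := by
        rw [← le_div_iff₀ hx2, one_div]
        linarith
      rw [hP]
      nlinarith
    · rw [max_eq_left h] at hP
      have h1 : 1 + P * x ^ 2 = ν * x ^ 2 := by
        rw [hP]
        field_simp
        ring
      rw [h1]
      exact le_of_eq (by ring)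
  have key : Real.log (1 + ρ * x ^ 2) - Real.log (1 + P * x ^ 2) ≤ (ρ - P) / ν := by
    rw [← Real.log_div hA.ne' hB.ne']
    refine (Real.log_le_sub_one_of_pos (div_pos hA hB)).trans (le_trans (le_of_eq ?_) slope)
    field_simp
    ring
  have : (ρ - P) * (ν * Real.log 2)⁻¹ = (ρ - P) / ν / Real.log 2 := by
    rw [div_div, div_eq_mul_inv]
  rw [this, Real.logb, Real.logb, ← add_div]
  gcongr
  linarith

/-- Waterfilling beats the uniform power allocation of the same total power. -/
theorem Rw_le_waterfilling (a b : ℝ) {ρ ν : ℝ} (hρ : 0 < ρ) (hν : 0 < ν)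
    (hwl : (∫ f in (0:ℝ)..1,
        if Hf a b f = 0 then 0 else max (ν - ((Hf a b f) ^ 2)⁻¹) 0) = ρ) :
    Rw a b ρ ≤ ∫ f in (0:ℝ)..1,
      Real.logb 2 (1 + max (ν - ((Hf a b f) ^ 2)⁻¹) 0 * (Hf a b f) ^ 2) := by
  have hP : IntervalIntegrable
      (fun f => if Hf a b f = 0 then 0 else max (ν - ((Hf a b f) ^ 2)⁻¹) 0)
      MeasureTheory.volume 0 1 := by
    by_contra h
    rw [intervalIntegral.integral_undef h] at hwl
    exact hρ.ne hwl
  have hW : IntervalIntegrable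
      (fun f => Real.logb 2 (1 + max (ν - ((Hf a b f) ^ 2)⁻¹) 0 * (Hf a b f) ^ 2))
      MeasureTheory.volume 0 1 := by
    simp only [waterfilling_mul_sq]
    apply Continuous.intervalIntegrable
    have := continuous_Hf a b
    refine Continuous.logb (by fun_prop) fun f => ?_
    positivity
  have hD := ((intervalIntegrable_const (c := ρ)).sub hP).mul_const (ν * Real.log 2)⁻¹
  refine (intervalIntegral.integral_mono_on zero_le_one (intervalIntegrable_rate a b ρ hρ.le)
    (hW.add hD) fun f _ => logb_le_waterfilling_add (Hf a b f) hν hρ.le).trans_eq ?_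
  rw [intervalIntegral.integral_add hW hD, intervalIntegral.integral_mul_const,
    intervalIntegral.integral_sub intervalIntegrable_const hP, hwl]
  simp

/-- The CF rate respects the cut-set-like upper bound
`R_ub = min{R_w(α,β,ρ₁), R_w^{wf}(η,γ,ρ₂)}`, where `R_w^{wf}(η,γ,ρ₂)` is the
waterfilling rate of the second lag with water level `ν`. -/
theorem stmt_11 (α β η γ ρ₁ ρ₂ rstar ν : ℝ)
    (hαβ : (α, β) ≠ (0, 0)) (hηγ : (η, γ) ≠ (0, 0))
    (hρ₁ : 0 < ρ₁) (hρ₂ : 0 < ρ₂)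
    (hr : 0 ≤ rstar)
    (hfp : Rw α β (ρ₁ * (1 - (2:ℝ) ^ (-rstar))) = Rw η γ ρ₂ - rstar)
    (hν : 0 < ν)
    (hwl : (∫ f in (0:ℝ)..1,
        if Hf η γ f = 0 then 0 else max (ν - ((Hf η γ f) ^ 2)⁻¹) 0) = ρ₂) :
    Rw α β (ρ₁ * (1 - (2:ℝ) ^ (-rstar))) ≤
      min (Rw α β ρ₁)
        (∫ f in (0:ℝ)..1,
          Real.logb 2 (1 + max (ν - ((Hf η γ f) ^ 2)⁻¹) 0 * (Hf η γ f) ^ 2)) := by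
  have h1 : (2:ℝ) ^ (-rstar) ≤ 1 := Real.rpow_le_one_of_one_le_of_nonpos one_le_two (by linarith)
  have h2 : 0 < (2:ℝ) ^ (-rstar) := by positivity
  refine le_min (Rw_mono α β (mul_nonneg hρ₁.le (by linarith)) (by nlinarith)) ?_
  have := Rw_le_waterfilling η γ hρ₂ hν hwl
  linarith
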